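/- Suppose that for all sufficiently large n, (1 + n^{-2}) p_{n+1}^(1/(n+1)) < p_n^(1/n). Then for all sufficiently large n, p_{n+1} - p_n < (ln p_n)^2 - 2 ln p_n + 1. -/

import Mathlib

open Filter Real

/-- `p n` is the n-th prime, 1-indexed: `p 1 = 2`. -/
noncomputable def p (n : ℕ) : ℕ := Nat.nth Nat.Prime (n - 1)


/-- auxiliary term: `(s-1) ∫_n^{n+1} (n^{-s} - x^{-s}) dx`, with `n` shifted by one -/
noncomputable def zb (n : ℕ) (s : ℂ) : ℂ :=
  (s - 1) * ((n : ℂ) + 1) ^ (-s) + (((n + 1 : ℕ) : ℂ) + 1) ^ (1 - s) - ((n : ℂ) + 1) ^ (1 - s)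

lemma zb_hasDerivAt_cpow (s : ℂ) {x : ℝ} (hx : 0 < x) :
    HasDerivAt (fun y : ℝ => (y : ℂ) ^ s) (s * (x : ℂ) ^ (s - 1)) x := by
  have h := (hasDerivAt_id (x : ℂ)).cpow_const (c := s) (Or.inl (by simpa using hx))
  simpa using h.comp_ofReal

lemma zb_diff1 {s : ℂ} (hs : 0 < s.re) {a x : ℝ} (ha : 0 < a) (hx : a ≤ x) (hx1 : x ≤ a + 1) :
    ‖(a : ℂ) ^ (-s) - (x : ℂ) ^ (-s)‖ ≤ ‖s‖ * a ^ (-s.re - 1) := by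
  have h := Convex.norm_image_sub_le_of_norm_hasDerivWithin_le (𝕜 := ℝ)
    (f := fun y : ℝ => (y : ℂ) ^ (-s)) (f' := fun y : ℝ => -s * (y : ℂ) ^ (-s - 1))
    (s := Set.Icc a (a + 1)) (x := a) (y := x) (C := ‖s‖ * a ^ (-s.re - 1))
    (fun y hy => (zb_hasDerivAt_cpow (-s) (lt_of_lt_of_le ha hy.1)).hasDerivWithinAt)
    (fun y hy => by
      rw [norm_mul, norm_neg, Complex.norm_cpow_eq_rpow_re_of_pos (lt_of_lt_of_le ha hy.1)]
      gcongr ?_ * ?_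
      have : (-s - 1).re = -s.re - 1 := by simp
      rw [this]
      exact Real.rpow_le_rpow_of_nonpos ha hy.1 (by linarith))
    (convex_Icc _ _) ⟨le_rfl, by linarith⟩ ⟨hx, hx1⟩
  rw [norm_sub_rev]
  refine h.trans ?_
  have h2 : ‖x - a‖ ≤ 1 := by rw [Real.norm_eq_abs, abs_le]; constructor <;> linarith
  have : 0 ≤ ‖s‖ * a ^ (-s.re - 1) := by positivity
  nlinarith

lemma zb_diff2 {s : ℂ} (hs : 0 < s.re) {a x : ℝ} (ha : 0 < a) (hx : a ≤ x) :
    ‖(a : ℂ) ^ (-s) - (x : ℂ) ^ (-s)‖ ≤ 2 * a ^ (-s.re) := by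
  refine (norm_sub_le _ _).trans ?_
  rw [Complex.norm_cpow_eq_rpow_re_of_pos ha,
    Complex.norm_cpow_eq_rpow_re_of_pos (lt_of_lt_of_le ha hx)]
  have : x ^ (-s).re ≤ a ^ (-s).re := Real.rpow_le_rpow_of_nonpos ha hx (by simp; linarith)
  simp only [Complex.neg_re] at *
  linarith

lemma zb_diff3 {s : ℂ} (hs : 0 < s.re) {a x θ : ℝ} (ha : 0 < a) (hx : a ≤ x) (hx1 : x ≤ a + 1)
    (h0 : 0 ≤ θ) (h1 : θ ≤ 1) :
    ‖(a : ℂ) ^ (-s) - (x : ℂ) ^ (-s)‖ ≤ 2 * ‖s‖ ^ θ * a ^ (-s.re - θ) := by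
  set z := ‖(a : ℂ) ^ (-s) - (x : ℂ) ^ (-s)‖ with hz
  have hz0 : 0 ≤ z := norm_nonneg _
  have e1 : z ^ θ ≤ (‖s‖ * a ^ (-s.re - 1)) ^ θ :=
    Real.rpow_le_rpow hz0 (zb_diff1 hs ha hx hx1) h0
  have e2 : z ^ (1 - θ) ≤ (2 * a ^ (-s.re)) ^ (1 - θ) :=
    Real.rpow_le_rpow hz0 (zb_diff2 hs ha hx) (by linarith)
  have e3 : z = z ^ θ * z ^ (1 - θ) := by
    rw [← Real.rpow_add' hz0 (by norm_num)]; norm_num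
  have e4 : (2 : ℝ) ^ (1 - θ) ≤ 2 := by
    calc (2 : ℝ) ^ (1 - θ) ≤ 2 ^ (1 : ℝ) :=
          Real.rpow_le_rpow_of_exponent_le (by norm_num) (by linarith)
      _ = 2 := by norm_num
  have e5 : (‖s‖ * a ^ (-s.re - 1)) ^ θ * (2 * a ^ (-s.re)) ^ (1 - θ) =
      2 ^ (1 - θ) * ‖s‖ ^ θ * a ^ (-s.re - θ) := by
    rw [Real.mul_rpow (by positivity) (by positivity), Real.mul_rpow (by positivity) (by positivity),
      ← Real.rpow_mul ha.le, ← Real.rpow_mul ha.le]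
    have : a ^ (-s.re - θ) = a ^ ((-s.re - 1) * θ) * a ^ (-s.re * (1 - θ)) := by
      rw [← Real.rpow_add ha]; ring_nf
    rw [this]; ring
  rw [e3]
  calc _ ≤ (‖s‖ * a ^ (-s.re - 1)) ^ θ * (2 * a ^ (-s.re)) ^ (1 - θ) := by gcongr
    _ = 2 ^ (1 - θ) * ‖s‖ ^ θ * a ^ (-s.re - θ) := e5
    _ ≤ _ := by gcongr

lemma zb_bound {s : ℂ} (hs : 0 < s.re) {θ : ℝ} (h0 : 0 ≤ θ) (h1 : θ ≤ 1) (n : ℕ) :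
    ‖zb n s‖ ≤ ‖s - 1‖ * (2 * ‖s‖ ^ θ * ((n : ℝ) + 1) ^ (-s.re - θ)) := by
  set a : ℝ := (n : ℝ) + 1 with ha'
  have ha : 0 < a := by positivity
  have h := Convex.norm_image_sub_le_of_norm_hasDerivWithin_le (𝕜 := ℝ)
    (f := fun y : ℝ => (s - 1) * (a : ℂ) ^ (-s) * (y : ℂ) + (y : ℂ) ^ (1 - s))
    (f' := fun y : ℝ => (s - 1) * ((a : ℂ) ^ (-s) - (y : ℂ) ^ (-s)))
    (s := Set.Icc a (a + 1)) (x := a) (y := a + 1)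
    (C := ‖s - 1‖ * (2 * ‖s‖ ^ θ * a ^ (-s.re - θ)))
    (fun y hy => by
      have h1 := zb_hasDerivAt_cpow (1 - s) (lt_of_lt_of_le ha hy.1)
      have h2 : HasDerivAt (fun y : ℝ => (s - 1) * (a : ℂ) ^ (-s) * (y : ℂ))
          ((s - 1) * (a : ℂ) ^ (-s) * 1) y :=
        (Complex.ofRealCLM.hasDerivAt).const_mul _
      have h3 := (h2.add h1).hasDerivWithinAt (s := Set.Icc a (a + 1))
      convert h3 using 1
      · rfl
      · have : (1 - s - 1) = -s := by ring
        rw [this]; ring)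
    (fun y hy => by
      rw [norm_mul]
      gcongr ?_ * ?_
      exact zb_diff3 hs ha hy.1 hy.2 h0 h1)
    (convex_Icc _ _) ⟨le_rfl, by linarith⟩ ⟨by linarith, le_rfl⟩
  have e : zb n s = ((s - 1) * (a : ℂ) ^ (-s) * ((a + 1 : ℝ) : ℂ) + ((a + 1 : ℝ) : ℂ) ^ (1 - s))
     - ((s - 1) * (a : ℂ) ^ (-s) * (a : ℂ) + (a : ℂ) ^ (1 - s)) := by
    simp only [zb, ha']; push_cast; ring
  rw [e]
  simpa using h

lemma zb_differentiable (n : ℕ) : Differentiable ℂ (zb n) := by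
  have h1 : ((n : ℂ) + 1) ≠ 0 := by exact_mod_cast Nat.succ_ne_zero n
  have h2 : (((n + 1 : ℕ) : ℂ) + 1) ≠ 0 := by exact_mod_cast Nat.succ_ne_zero (n + 1)
  unfold zb
  intro s
  have a1 : DifferentiableAt ℂ (fun s : ℂ => ((n : ℂ) + 1) ^ (-s)) s :=
    DifferentiableAt.const_cpow (by fun_prop) (Or.inl h1)
  have a2 : DifferentiableAt ℂ (fun s : ℂ => ((n : ℂ) + 1) ^ (1 - s)) s :=
    DifferentiableAt.const_cpow (by fun_prop) (Or.inl h1)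
  have a3 : DifferentiableAt ℂ (fun s : ℂ => (((n + 1 : ℕ) : ℂ) + 1) ^ (1 - s)) s :=
    DifferentiableAt.const_cpow (by fun_prop) (Or.inl h2)
  fun_prop

lemma zb_summable_rpow {c : ℝ} (hc : c < -1) : Summable (fun n : ℕ => ((n : ℝ) + 1) ^ c) := by
  have := (summable_nat_add_iff 1).mpr (Real.summable_nat_rpow.mpr hc)
  simpa using this

lemma zb_tsum_of_one_lt {s : ℂ} (hs : 1 < s.re) : ∑' n, zb n s = riemannZeta₁ s - 1 := by
  have hs1 : s ≠ 1 := by rintro rfl; simp at hs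
  have hS : Summable (fun n => zb n s) := by
    refine Summable.of_norm_bounded (g := fun n : ℕ =>
      ‖s - 1‖ * (2 * ‖s‖ ^ (0 : ℝ) * ((n : ℝ) + 1) ^ (-s.re - 0))) ?_
      (fun n => zb_bound (by linarith) le_rfl zero_le_one n)
    exact ((zb_summable_rpow (by linarith)).mul_left _).mul_left _
  have hz : Summable (fun n : ℕ => (s - 1) * ((n : ℂ) + 1) ^ (-s)) := by
    refine Summable.mul_left _ ?_
    refine Summable.of_norm_bounded (zb_summable_rpow (c := -s.re) (by linarith)) fun n => ?_
    have : ((n : ℂ) + 1) = (((n : ℝ) + 1 : ℝ) : ℂ) := by push_cast; rfl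
    rw [this, Complex.norm_cpow_eq_rpow_re_of_pos (by positivity)]; simp
  have hd := hS.sub hz
  have ht : Tendsto (fun N : ℕ => ∑ n ∈ Finset.range N, (zb n s - (s - 1) * ((n : ℂ) + 1) ^ (-s)))
      atTop (nhds (-1)) := by
    have e : ∀ N : ℕ, ∑ n ∈ Finset.range N, (zb n s - (s - 1) * ((n : ℂ) + 1) ^ (-s))
        = ((N : ℂ) + 1) ^ (1 - s) - 1 := by
      intro N
      have := Finset.sum_range_sub (fun n : ℕ => ((n : ℂ) + 1) ^ (1 - s)) N
      simp only [Nat.cast_zero, zero_add, Complex.one_cpow] at this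
      rw [← this]
      refine Finset.sum_congr rfl fun n _ => ?_
      simp only [zb]; ring
    simp_rw [e]
    have : Tendsto (fun N : ℕ => ((N : ℂ) + 1) ^ (1 - s)) atTop (nhds 0) := by
      rw [tendsto_zero_iff_norm_tendsto_zero]
      have e2 : ∀ N : ℕ, ‖((N : ℂ) + 1) ^ (1 - s)‖ = ((N : ℝ) + 1) ^ (-(s.re - 1)) := by
        intro N
        have : ((N : ℂ) + 1) = (((N : ℝ) + 1 : ℝ) : ℂ) := by push_cast; rfl
        rw [this, Complex.norm_cpow_eq_rpow_re_of_pos (by positivity)]; simp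
      simp_rw [e2]
      exact (tendsto_rpow_neg_atTop (by linarith)).comp
        (tendsto_atTop_add_const_right _ _ tendsto_natCast_atTop_atTop)
    simpa using this.sub_const 1
  have ht2 := tendsto_nhds_unique hd.hasSum.tendsto_sum_nat ht
  rw [hS.tsum_sub hz, tsum_mul_left] at ht2
  have h3 : riemannZeta s = ∑' n : ℕ, ((n : ℂ) + 1) ^ (-s) := by
    rw [zeta_eq_tsum_one_div_nat_add_one_cpow hs]
    refine tsum_congr fun n => ?_
    rw [Complex.cpow_neg]; simp
  have h4 := riemannZeta_eq_inv_sub_mul hs1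
  have : s - 1 ≠ 0 := sub_ne_zero.mpr hs1
  rw [← h3, h4, ← mul_assoc, mul_inv_cancel₀ this] at ht2
  linear_combination ht2

lemma zb_tsum {s : ℂ} (hs : 59 / 60 < s.re) : ∑' n, zb n s = riemannZeta₁ s - 1 := by
  set R : ℝ := ‖s‖ + 3
  set U : Set ℂ := {z | 59 / 60 < z.re} ∩ Metric.ball 0 R with hU
  have hUo : IsOpen U := (isOpen_lt continuous_const Complex.continuous_re).inter Metric.isOpen_ball
  have hUc : Convex ℝ U := (convex_halfSpace_re_gt _).inter (convex_ball _ _)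
  have hd : DifferentiableOn ℂ (fun z => ∑' n, zb n z) U := by
    refine Complex.differentiableOn_tsum_of_summable_norm
      (u := fun n : ℕ => (R + 1) * (2 * R ^ (1 / 30 : ℝ) * ((n : ℝ) + 1) ^ (-61 / 60 : ℝ)))
      (((zb_summable_rpow (by norm_num)).mul_left _).mul_left _)
      (fun n => (zb_differentiable n).differentiableOn) hUo fun n z hz => ?_
    have hz1 : 59 / 60 < z.re := hz.1
    have hz2 : ‖z‖ < R := by simpa using hz.2
    refine (zb_bound (θ := 1 / 30) (by linarith) (by norm_num) (by norm_num) n).trans ?_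
    have : ‖z - 1‖ ≤ R + 1 := (norm_sub_le _ _).trans (by simp; linarith)
    gcongr
    · linarith
    · linarith
  have hf := hd.analyticOnNhd hUo
  have hg : AnalyticOnNhd ℂ (fun z => riemannZeta₁ z - 1) U :=
    (differentiable_riemannZeta₁.sub_const 1).differentiableOn.analyticOnNhd hUo
  have h2 : (2 : ℂ) ∈ U := by
    refine ⟨by simp; norm_num, ?_⟩
    simp [R]; linarith [norm_nonneg s]
  refine hf.eqOn_of_preconnected_of_eventuallyEq hg hUc.isPreconnected h2 ?_ ⟨hs, by simp [R]⟩
  have : {z : ℂ | 1 < z.re} ∈ nhds (2 : ℂ) :=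
    (isOpen_lt continuous_const Complex.continuous_re).mem_nhds (by simp)
  filter_upwards [this] with z hz
  exact zb_tsum_of_one_lt hz

lemma zeta0_bound : ∃ C : ℝ, 1 ≤ C ∧ ∀ s : ℂ, 59 / 60 < s.re → s ≠ 1 →
    ‖riemannZeta₀ s‖ ≤ C * ‖s‖ ^ (1 / 30 : ℝ) := by
  set S := ∑' n : ℕ, ((n : ℝ) + 1) ^ (-61 / 60 : ℝ) with hS
  have hsum : Summable (fun n : ℕ => ((n : ℝ) + 1) ^ (-61 / 60 : ℝ)) :=
    zb_summable_rpow (by norm_num)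
  have hS0 : 0 ≤ S := tsum_nonneg fun n => by positivity
  refine ⟨2 * S + 1, by linarith, fun s hs hs1 => ?_⟩
  have h1 : ‖∑' n, zb n s‖ ≤ ‖s - 1‖ * (2 * ‖s‖ ^ (1 / 30 : ℝ) * S) := by
    refine tsum_of_norm_bounded ((hsum.hasSum.mul_left _).mul_left _) fun n => ?_
    refine (zb_bound (θ := 1 / 30) (by linarith) (by norm_num) (by norm_num) n).trans ?_
    gcongr
    · simp
    · linarith
  rw [zb_tsum hs] at h1
  have h2 : riemannZeta₁ s - 1 = (s - 1) * riemannZeta₀ s := by simp [riemannZeta₁]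
  rw [h2, norm_mul] at h1
  have h3 : 0 < ‖s - 1‖ := norm_pos_iff.mpr (sub_ne_zero.mpr hs1)
  have h4 := le_of_mul_le_mul_left h1 h3
  have : 0 ≤ ‖s‖ ^ (1 / 30 : ℝ) := by positivity
  nlinarith


lemma zeta_upper : ∃ B : ℝ, 1 ≤ B ∧ ∀ y : ℝ, 2 ≤ |y| → ∀ s : ℂ, 119 / 120 ≤ s.re → s.re ≤ 3 →
    |y| / 2 ≤ |s.im| → |s.im| ≤ 2 * |y| →
    ‖riemannZeta s‖ ≤ B * |y| ^ (1 / 30 : ℝ) ∧ ‖deriv riemannZeta s‖ ≤ B * |y| ^ (1 / 30 : ℝ) := by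
  obtain ⟨C, hC1, hC⟩ := zeta0_bound
  refine ⟨960 * C + 1, by linarith, fun y hy s h1 h2 h3 h4 => ?_⟩
  set q := |y| ^ (1 / 30 : ℝ) with hq
  have hq1 : 1 ≤ q := Real.one_le_rpow (by linarith) (by norm_num)
  have key : ∀ z : ℂ, ‖z - s‖ ≤ 1 / 240 → ‖riemannZeta₀ z‖ ≤ 4 * C * q := by
    intro z hz
    have hre : |z.re - s.re| ≤ 1 / 240 := by
      have := Complex.abs_re_le_norm (z - s); simp only [Complex.sub_re] at this; linarith
    have him : |z.im - s.im| ≤ 1 / 240 := by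
      have := Complex.abs_im_le_norm (z - s); simp only [Complex.sub_im] at this; linarith
    have him2 : |s.im| - |z.im| ≤ 1 / 240 := (abs_sub_abs_le_abs_sub _ _).trans (by
      rw [abs_sub_comm]; exact him)
    have him3 : |z.im| - |s.im| ≤ 1 / 240 := (abs_sub_abs_le_abs_sub _ _).trans him
    rw [abs_le] at hre
    have hz1 : z ≠ 1 := by
      rintro rfl
      simp at him2
      linarith
    have hzn : ‖z‖ ≤ 4 * |y| := by
      have := Complex.norm_le_abs_re_add_abs_im z
      have h5 : |z.re| ≤ 3 + 1 / 240 := by rw [abs_le]; constructor <;> linarith [hre.1, hre.2]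
      linarith
    refine (hC z (by linarith [hre.1]) hz1).trans ?_
    have : ‖z‖ ^ (1 / 30 : ℝ) ≤ 4 * q := by
      calc ‖z‖ ^ (1 / 30 : ℝ) ≤ (4 * |y|) ^ (1 / 30 : ℝ) := by gcongr
        _ = 4 ^ (1 / 30 : ℝ) * q := by rw [Real.mul_rpow (by norm_num) (by positivity)]
        _ ≤ 4 * q := by
          gcongr
          calc (4 : ℝ) ^ (1 / 30 : ℝ) ≤ 4 ^ (1 : ℝ) :=
                Real.rpow_le_rpow_of_exponent_le (by norm_num) (by norm_num)
            _ = 4 := by norm_num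
    nlinarith
  have hs1 : s ≠ 1 := by
    rintro rfl
    simp at h3
    have := abs_pos_of_pos (show (0 : ℝ) < 1 by norm_num)
    linarith
  have hn1 : 1 ≤ ‖s - 1‖ := by
    have := Complex.abs_im_le_norm (s - 1); simp at this; linarith
  have hn2 : ‖(s - 1)⁻¹‖ ≤ 1 := by rw [norm_inv]; exact inv_le_one_of_one_le₀ hn1
  constructor
  · rw [riemannZeta_eq_inv_sub_add hs1]
    refine (norm_add_le _ _).trans ?_
    have := key s (by simp)
    nlinarith
  · rw [deriv_riemannZeta_eq_neg_inv_sub_sq_add hs1]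
    refine (norm_add_le _ _).trans ?_
    have hd : ‖deriv riemannZeta₀ s‖ ≤ 4 * C * q / (1 / 240) := by
      refine Complex.norm_deriv_le_of_forall_mem_sphere_norm_le (by norm_num)
        differentiable_riemannZeta₀.diffContOnCl fun z hz => key z ?_
      rw [mem_sphere_iff_norm] at hz; exact hz.le
    have : ‖-((s - 1)⁻¹) ^ 2‖ ≤ 1 := by
      rw [norm_neg, norm_pow]; exact pow_le_one₀ (norm_nonneg _) hn2
    rw [div_eq_mul_inv] at hd
    norm_num at hd
    nlinarith

lemma zeta_near_one : ∃ C : ℝ, 1 ≤ C ∧ ∀ x : ℝ, 0 < x → x ≤ 1 →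
    ‖riemannZeta (1 + x)‖ ≤ C / x := by
  obtain ⟨C, hC1, hC⟩ := zeta0_bound
  refine ⟨1 + 2 * C, by linarith, fun x hx hx1 => ?_⟩
  have h1 : (1 + (x : ℂ)) ≠ 1 := by simpa using hx.ne'
  rw [riemannZeta_eq_inv_sub_add h1]
  refine (norm_add_le _ _).trans ?_
  have h2 := hC (1 + x) (by simp; linarith) h1
  have h3 : ‖(1 + (x : ℂ) - 1)⁻¹‖ = 1 / x := by
    simp [abs_of_pos hx]
  have h4 : ‖(1 + (x : ℂ))‖ = 1 + x := by
    have : (1 + (x : ℂ)) = ((1 + x : ℝ) : ℂ) := by push_cast; rfl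
    rw [this, Complex.norm_real, Real.norm_eq_abs, abs_of_pos (by linarith)]
  rw [h4] at h2
  have h5 : (1 + x) ^ (1 / 30 : ℝ) ≤ 2 := by
    calc (1 + x) ^ (1 / 30 : ℝ) ≤ (1 + x) ^ (1 : ℝ) :=
          Real.rpow_le_rpow_of_exponent_le (by linarith) (by norm_num)
      _ ≤ 2 := by rw [Real.rpow_one]; linarith
  have h6 : C * (1 + x) ^ (1 / 30 : ℝ) ≤ 2 * C / x := by
    rw [le_div_iff₀ hx]
    have : 0 ≤ (1 + x) ^ (1 / 30 : ℝ) := by positivity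
    nlinarith [mul_nonneg (by linarith : 0 ≤ C) this]
  rw [h3, add_div]
  linarith

/-- 3-4-1 lower bound, and the resulting lower bound up to the line -/
lemma zeta_lower : ∃ B κ : ℝ, 1 ≤ B ∧ 0 < κ ∧ κ ≤ 1 / 100 ∧
    (∀ y : ℝ, 2 ≤ |y| → ∀ s : ℂ, 119 / 120 ≤ s.re → s.re ≤ 3 →
      |y| / 2 ≤ |s.im| → |s.im| ≤ 2 * |y| →
      ‖riemannZeta s‖ ≤ B * |y| ^ (1 / 30 : ℝ) ∧ ‖deriv riemannZeta s‖ ≤ B * |y| ^ (1 / 30 : ℝ)) ∧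
    (∀ y : ℝ, 2 ≤ |y| → ∀ x : ℝ, 0 < x → x ≤ 1 →
      B * κ / (|y| ^ (1 / 30 : ℝ)) ^ 4 ≤ ‖riemannZeta (1 + x + Complex.I * y)‖) := by
  obtain ⟨B0, hB0, hB⟩ := zeta_upper
  obtain ⟨C, hC1, hC⟩ := zeta_near_one
  set B := 2 * B0 with hBdef
  have hB1 : 1 ≤ B := by linarith
  set c : ℝ := 1 / (C ^ 3 * B) with hc
  have hc0 : 0 < c := by positivity
  have hc1 : c ≤ 1 := by
    rw [hc, div_le_one (by positivity)]
    nlinarith [one_le_pow₀ hC1 (n := 3)]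
  set κ : ℝ := c / (100 * B ^ 4) with hκ
  have hκ0 : 0 < κ := by positivity
  have hκ1 : κ ≤ 1 / 100 := by
    rw [hκ, div_le_div_iff₀ (by positivity) (by norm_num)]
    nlinarith [one_le_pow₀ hB1 (n := 4)]
  refine ⟨B, κ, hB1, hκ0, hκ1, fun y hy s h1 h2 h3 h4 => ?_, fun y hy x hx hx1 => ?_⟩
  · have := hB y hy s h1 h2 h3 h4
    have h0 : 0 ≤ |y| ^ (1 / 30 : ℝ) := by positivity
    constructor <;> nlinarith
  set q := |y| ^ (1 / 30 : ℝ) with hq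
  have hq1 : 1 ≤ q := Real.one_le_rpow (by linarith) (by norm_num)
  have t41 : ∀ u : ℝ, 0 < u → u ≤ 1 → c * u ^ 3 / q ≤ ‖riemannZeta (1 + u + Complex.I * y)‖ ^ 4 := by
    intro u hu hu1
    have h := DirichletCharacter.norm_LFunction_product_ge_one (N := 1) (χ := 1) hu y
    simp only [DirichletCharacter.LFunctionTrivChar, DirichletCharacter.LFunction_modOne_eq,
      norm_mul, norm_pow] at h
    have e1 := hC u hu hu1
    have e2 := (hB y hy (1 + u + 2 * Complex.I * y) (by simp; linarith) (by simp; linarith)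
      (by simp [abs_mul]; linarith [abs_nonneg y]) (by simp [abs_mul])).1
    set Z := ‖riemannZeta (1 + u + Complex.I * y)‖
    have hZ : 0 ≤ Z := norm_nonneg _
    have e3 : 1 ≤ (C / u) ^ 3 * Z ^ 4 * (B * q) := by
      refine h.le.trans ?_
      gcongr
      refine e2.trans ?_
      gcongr
      linarith
    rw [hc, div_le_iff₀ (by positivity), one_div, inv_mul_le_iff₀ (by positivity)]
    have : (C / u) ^ 3 * Z ^ 4 * (B * q) * u ^ 3 = C ^ 3 * B * (Z ^ 4 * q) := by
      field_simp
    rw [← this]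
    have hu3 : 0 < u ^ 3 := by positivity
    nlinarith
  set d : ℝ := κ / q ^ 5 with hd
  have hq5 : 1 ≤ q ^ 5 := one_le_pow₀ hq1
  have hd0 : 0 < d := by positivity
  have hd1 : d ≤ 1 / 100 := by
    rw [hd, div_le_iff₀ (by positivity)]; nlinarith
  have big : ∀ u : ℝ, d ≤ u → u ≤ 1 → 2 * B * κ / q ^ 4 ≤ ‖riemannZeta (1 + u + Complex.I * y)‖ := by
    intro u hdu hu1
    have h := t41 u (by linarith) hu1
    refine le_of_pow_le_pow_left₀ (n := 4) (by norm_num) (norm_nonneg _) (le_trans ?_ h)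
    have e1 : c * d ^ 3 / q ≤ c * u ^ 3 / q := by gcongr
    refine le_trans ?_ e1
    have hc' : c = 100 * B ^ 4 * κ := by rw [hκ]; field_simp
    rw [hd, hc']
    have : 100 * B ^ 4 * κ * (κ / q ^ 5) ^ 3 / q = 100 * B ^ 4 * κ ^ 4 / q ^ 16 := by
      field_simp
    rw [this]
    have : (2 * B * κ / q ^ 4) ^ 4 = 16 * B ^ 4 * κ ^ 4 / q ^ 16 := by
      field_simp; ring
    rw [this]
    gcongr
    norm_num
  have hpos : 0 ≤ B * κ / q ^ 4 := by positivity
  rcases le_or_gt d x with hdx | hdx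
  · have := big x hdx hx1
    have e : 2 * B * κ / q ^ 4 = 2 * (B * κ / q ^ 4) := by ring
    linarith
  · have h1 := big d le_rfl (by linarith)
    have h2 := Convex.norm_image_sub_le_of_norm_deriv_le (𝕜 := ℂ) (f := riemannZeta)
      (s := {z : ℂ | 1 ≤ z.re} ∩ {z : ℂ | z.re ≤ 3} ∩ {z : ℂ | z.im = y}) (C := B * q)
      (x := 1 + x + Complex.I * y) (y := 1 + d + Complex.I * y)
      (fun z hz => differentiableAt_riemannZeta (by
        rintro rfl
        have h2 : (1 : ℂ).im = y := hz.2
        simp at h2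
        rw [← h2] at hy; simp at hy; linarith))
      (fun z hz => by
        obtain ⟨⟨z1, z2⟩, z3⟩ := hz
        simp only [Set.mem_ofPred_eq] at z1 z2 z3
        have := (hB y hy z (by linarith) z2 (by rw [z3]; linarith) (by rw [z3]; linarith)).2
        refine this.trans ?_
        gcongr
        linarith)
      (((convex_halfSpace_re_ge 1).inter (convex_halfSpace_re_le 3)).inter (by
        intro a ha b hb α β _ _ hαβ
        simp only [Set.mem_ofPred_eq] at ha hb ⊢
        simp [ha, hb]
        rw [← add_mul, hαβ, one_mul]))
      ⟨⟨by simp; linarith, by simp; linarith⟩, by simp⟩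
      ⟨⟨by simp; linarith, by simp; linarith⟩, by simp⟩
    have h3 : ‖(1 + (d : ℂ) + Complex.I * y) - (1 + x + Complex.I * y)‖ ≤ d := by
      have : (1 + (d : ℂ) + Complex.I * y) - (1 + x + Complex.I * y) = ((d - x : ℝ) : ℂ) := by
        push_cast; ring
      rw [this, Complex.norm_real, Real.norm_eq_abs, abs_of_pos (by linarith)]
      linarith
    have h4 : ‖riemannZeta (1 + d + Complex.I * y)‖ - ‖riemannZeta (1 + x + Complex.I * y)‖ ≤
        B * q * d := by
      refine (norm_sub_norm_le _ _).trans (h2.trans ?_)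
      gcongr
    have h5 : B * q * d = B * κ / q ^ 4 := by rw [hd]; field_simp
    have e : 2 * B * κ / q ^ 4 = 2 * (B * κ / q ^ 4) := by ring
    linarith


/-- the analytic continuation of minus zeta log-derivative over s -/
noncomputable def Hf (s : ℂ) : ℂ := -(1 + deriv riemannZeta₁ s / riemannZeta₁ s) / s

lemma Hf_eq {s : ℂ} (hs : s ≠ 1) (hs0 : s ≠ 0) (hz : riemannZeta s ≠ 0) :
    Hf s = -(deriv riemannZeta s / riemannZeta s) / s - (s - 1)⁻¹ := by
  have h1 := deriv_riemannZeta_eq_neg_inv_sub_sq_mul_add hs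
  have h2 := riemannZeta_eq_inv_sub_mul hs
  have h3 : s - 1 ≠ 0 := sub_ne_zero.mpr hs
  have h4 : riemannZeta₁ s ≠ 0 := by
    intro h; rw [h, mul_zero] at h2; exact hz h2
  rw [Hf, h1, h2]
  field_simp
  ring

lemma zeta1_ne_zero {s : ℂ} (hz : riemannZeta s ≠ 0) : riemannZeta₁ s ≠ 0 := by
  rcases eq_or_ne s 1 with rfl | hs
  · simp
  · intro h
    rw [riemannZeta_eq_inv_sub_mul hs, h, mul_zero] at hz
    exact hz rfl

lemma Hf_analyticAt {s : ℂ} (hs0 : s ≠ 0) (hz : riemannZeta s ≠ 0) : AnalyticAt ℂ Hf s := by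
  have h1 : AnalyticAt ℂ riemannZeta₁ s := differentiable_riemannZeta₁.analyticAt s
  have h2 := zeta1_ne_zero hz
  unfold Hf
  exact ((analyticAt_const.add (h1.deriv.div h1 h2)).neg).div analyticAt_id hs0

lemma Hf_large : ∃ C : ℝ, ∀ x y : ℝ, 0 < x → x ≤ 1 → 2 ≤ |y| →
    ‖iteratedDeriv 5 Hf (1 + x + Complex.I * y)‖ ≤ C := by
  obtain ⟨B, κ, hB1, hκ0, hκ1, hU, hL⟩ := zeta_lower
  refine ⟨(Nat.factorial 5) * ((4 / κ + 2) * (2 / κ) ^ 5), fun x y hx hx1 hy => ?_⟩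
  set q := |y| ^ (1 / 30 : ℝ) with hq
  have hq1 : 1 ≤ q := Real.one_le_rpow (by linarith) (by norm_num)
  have hq30 : q ^ 30 = |y| := by
    rw [hq, ← Real.rpow_natCast, ← Real.rpow_mul (abs_nonneg y)]; norm_num
  set s0 : ℂ := 1 + x + Complex.I * y with hs0
  set r : ℝ := κ / (2 * q ^ 5) with hr
  have hq5 : 1 ≤ q ^ 5 := one_le_pow₀ hq1
  have hr0 : 0 < r := by positivity
  have hr1 : r ≤ 1 / 200 := by
    rw [hr, div_le_iff₀ (by positivity)]; nlinarith
  have geo : ∀ z ∈ Metric.closedBall s0 r, 119 / 120 ≤ z.re ∧ z.re ≤ 3 ∧ |y| / 2 ≤ |z.im| ∧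
      |z.im| ≤ 2 * |y| := by
    intro z hz
    rw [mem_closedBall_iff_norm] at hz
    have hre : |z.re - (1 + x)| ≤ r := by
      have := Complex.abs_re_le_norm (z - s0); simp [hs0] at this hz; linarith
    have him : |z.im - y| ≤ r := by
      have := Complex.abs_im_le_norm (z - s0); simp [hs0] at this hz; linarith
    have him2 : |y| - |z.im| ≤ r := (abs_sub_abs_le_abs_sub _ _).trans (by
      rw [abs_sub_comm]; exact him)
    have him3 : |z.im| - |y| ≤ r := (abs_sub_abs_le_abs_sub _ _).trans him
    rw [abs_le] at hre
    refine ⟨by linarith [hre.1], by linarith [hre.2], by linarith, by linarith⟩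
  have ne1 : ∀ z ∈ Metric.closedBall s0 r, z ≠ 1 := by
    rintro z hz rfl
    have := (geo 1 hz).2.2.1
    simp at this
    linarith
  have ne0 : ∀ z ∈ Metric.closedBall s0 r, z ≠ 0 := by
    rintro z hz rfl
    have := (geo 0 hz).1
    simp at this; linarith
  have low : ∀ z ∈ Metric.closedBall s0 r, B * κ / q ^ 4 / 2 ≤ ‖riemannZeta z‖ := by
    intro z hz
    have h2 := Convex.norm_image_sub_le_of_norm_deriv_le (𝕜 := ℂ) (f := riemannZeta)
      (s := Metric.closedBall s0 r) (C := B * q) (x := z) (y := s0)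
      (fun z hz => differentiableAt_riemannZeta (ne1 z hz))
      (fun z hz => by
        obtain ⟨g1, g2, g3, g4⟩ := geo z hz
        exact (hU y hy z g1 g2 g3 g4).2)
      (convex_closedBall _ _) hz (Metric.mem_closedBall_self hr0.le)
    have h3 : ‖s0 - z‖ ≤ r := by rw [norm_sub_rev]; exact mem_closedBall_iff_norm.mp hz
    have h4 : ‖riemannZeta s0‖ - ‖riemannZeta z‖ ≤ B * q * r := by
      refine (norm_sub_norm_le _ _).trans (h2.trans ?_)
      gcongr
    have h5 : B * q * r = B * κ / q ^ 4 / 2 := by rw [hr]; field_simp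
    have h6 := hL y hy x hx hx1
    linarith
  have hlowpos : 0 < B * κ / q ^ 4 / 2 := by positivity
  have nez : ∀ z ∈ Metric.closedBall s0 r, riemannZeta z ≠ 0 := fun z hz h => by
    have := low z hz
    rw [h, norm_zero] at this; linarith
  have hdiff : DiffContOnCl ℂ Hf (Metric.ball s0 r) := by
    apply DifferentiableOn.diffContOnCl
    rw [closure_ball _ hr0.ne']
    exact fun z hz => (Hf_analyticAt (ne0 z hz) (nez z hz)).differentiableAt.differentiableWithinAt
  have hbd : ∀ z ∈ Metric.sphere s0 r, ‖Hf z‖ ≤ (4 / κ + 2) * q ^ 5 / |y| := by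
    intro z hz'
    have hz := Metric.sphere_subset_closedBall hz'
    obtain ⟨g1, g2, g3, g4⟩ := geo z hz
    rw [Hf_eq (ne1 z hz) (ne0 z hz) (nez z hz)]
    refine (norm_sub_le _ _).trans ?_
    rw [norm_div, norm_neg, norm_div, norm_inv]
    have n1 : |y| / 2 ≤ ‖z‖ := g3.trans (Complex.abs_im_le_norm z)
    have n2 : |y| / 2 ≤ ‖z - 1‖ := by
      have := Complex.abs_im_le_norm (z - 1); simp at this; linarith
    have hy0 : 0 < |y| / 2 := by linarith
    have t1 : ‖deriv riemannZeta z‖ / ‖riemannZeta z‖ / ‖z‖ ≤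
        (B * q) / (B * κ / q ^ 4 / 2) / (|y| / 2) := by
      have := (hU y hy z g1 g2 g3 g4).2
      have := low z hz
      gcongr
    have t2 : ‖z - 1‖⁻¹ ≤ (|y| / 2)⁻¹ := by gcongr
    have t3 : (B * q) / (B * κ / q ^ 4 / 2) / (|y| / 2) = 4 / κ * q ^ 5 / |y| := by
      field_simp; ring
    have t4 : (|y| / 2)⁻¹ ≤ 2 * q ^ 5 / |y| := by
      rw [inv_div]; gcongr; linarith
    calc _ ≤ 4 / κ * q ^ 5 / |y| + 2 * q ^ 5 / |y| := by linarith
      _ = _ := by ring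
  refine (Complex.norm_iteratedDeriv_le_of_forall_mem_sphere_norm_le 5 hr0 hdiff hbd).trans
    (le_of_eq ?_)
  rw [hr, ← hq30]
  field_simp
  try ring

lemma Hf_bound : ∃ C : ℝ, 0 < C ∧ ∀ x y : ℝ, 0 < x → x ≤ 1 →
    ‖iteratedDeriv 5 Hf (1 + x + Complex.I * y)‖ ≤ C := by
  obtain ⟨C1, hC1⟩ := Hf_large
  have hK : IsCompact (Set.Icc (0 : ℝ) 1 ×ˢ Set.Icc (-2 : ℝ) 2) := isCompact_Icc.prod isCompact_Icc
  obtain ⟨C2, hC2⟩ := hK.exists_bound_of_continuousOn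
    (f := fun v : ℝ × ℝ => iteratedDeriv 5 Hf (1 + (v.1 : ℂ) + Complex.I * (v.2 : ℂ))) (by
      intro v hv
      apply ContinuousAt.continuousWithinAt
      have hre : 1 ≤ (1 + (v.1 : ℂ) + Complex.I * (v.2 : ℂ)).re := by
        have := hv.1.1; simpa using this
      have h0 : (1 + (v.1 : ℂ) + Complex.I * (v.2 : ℂ)) ≠ 0 := by
        intro h; rw [h] at hre; simp at hre; linarith
      have ha : AnalyticAt ℂ (iteratedDeriv 5 Hf) (1 + (v.1 : ℂ) + Complex.I * (v.2 : ℂ)) := by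
        rw [iteratedDeriv_eq_iterate]
        exact AnalyticAt.iterated_deriv (Hf_analyticAt h0 (riemannZeta_ne_zero_of_one_le_re hre)) 5
      exact ContinuousAt.comp (f := fun v : ℝ × ℝ => (1 + (v.1 : ℂ) + Complex.I * (v.2 : ℂ)))
        (g := iteratedDeriv 5 Hf) ha.continuousAt (by fun_prop))
  refine ⟨|C1| + |C2| + 1, by positivity, fun x y hx hx1 => ?_⟩
  rcases le_total 2 |y| with h | h
  · linarith [hC1 x y hx hx1 h, le_abs_self C1, abs_nonneg C2]
  · have := hC2 (x, y) ⟨⟨hx.le, hx1⟩, abs_le.mp h⟩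
    simp only at this
    linarith [le_abs_self C2, abs_nonneg C1]


noncomputable def Ef (v : ℝ) : ℝ := Chebyshev.psi (Real.exp v) * Real.exp (-v) - 1

theorem Ef_meas : Measurable Ef := by
  unfold Ef
  have := Chebyshev.psi_mono.measurable
  fun_prop

theorem Ef_bound (v : ℝ) : |Ef v| ≤ 6 := by
  have h1 := Chebyshev.psi_nonneg (Real.exp v)
  have h2 := Chebyshev.psi_le_const_mul_self (Real.exp_pos v).le
  have h3 : Real.exp v * Real.exp (-v) = 1 := by rw [← Real.exp_add]; simp
  have h4 := Real.exp_pos (-v)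
  have h5 : Real.log 4 ≤ 2 := by
    have : (4:ℝ) = 2 ^ 2 := by norm_num
    rw [this, Real.log_pow]
    have := Real.log_two_lt_d9
    push_cast; linarith
  have h6 : Chebyshev.psi (Real.exp v) * Real.exp (-v) ≤ Real.log 4 + 4 := by
    calc _ ≤ ((Real.log 4 + 4) * Real.exp v) * Real.exp (-v) := by gcongr
      _ = _ := by rw [mul_assoc, h3, mul_one]
  have h7 : 0 ≤ Chebyshev.psi (Real.exp v) * Real.exp (-v) := by positivity
  unfold Ef
  rw [abs_le]; constructor <;> linarith

noncomputable def Fi (k : ℕ) (z : ℂ) (v : ℝ) : ℂ := ((v ^ k * Ef v : ℝ) : ℂ) * Complex.exp (-z * v)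

theorem Fi_meas (k : ℕ) (z : ℂ) : Measurable (Fi k z) := by
  unfold Fi
  have := Ef_meas
  fun_prop

theorem Fi_bound (k : ℕ) (z : ℂ) (v b : ℝ) (hv : 0 < v) (hb : b ≤ z.re) :
    ‖Fi k z v‖ ≤ 6 * (v ^ k * Real.exp (-b * v)) := by
  unfold Fi
  rw [norm_mul, Complex.norm_exp, Complex.norm_real, norm_mul, Real.norm_eq_abs, Real.norm_eq_abs,
    abs_of_pos (pow_pos hv k)]
  have h1 : (-z * (v:ℂ)).re = - z.re * v := by simp
  rw [h1]
  have h2 := Ef_bound v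
  have h3 : Real.exp (-z.re * v) ≤ Real.exp (-b * v) := by
    apply Real.exp_le_exp.mpr; nlinarith
  calc v ^ k * |Ef v| * Real.exp (-z.re * v) ≤ v ^ k * 6 * Real.exp (-b * v) := by gcongr
    _ = _ := by ring

theorem bd_int (k : ℕ) (b : ℝ) (hb : 0 < b) :
    MeasureTheory.IntegrableOn (fun v : ℝ => 6 * (v ^ k * Real.exp (-b * v))) (Set.Ioi 0) := by
  have := integrableOn_rpow_mul_exp_neg_mul_rpow (p := 1) (s := k) (b := b)
    (by have : (0:ℝ) ≤ k := by positivity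
        linarith) one_pos hb
  simp only [Real.rpow_natCast, Real.rpow_one] at this
  exact this.const_mul 6

theorem Fi_int (k : ℕ) (z : ℂ) (hz : 0 < z.re) :
    MeasureTheory.IntegrableOn (Fi k z) (Set.Ioi 0) := by
  refine MeasureTheory.Integrable.mono' (bd_int k z.re hz) (Fi_meas k z).aestronglyMeasurable ?_
  filter_upwards [MeasureTheory.ae_restrict_mem measurableSet_Ioi] with v hv
  exact Fi_bound k z v _ hv le_rfl

noncomputable def Ff (k : ℕ) (z : ℂ) : ℂ := ∫ v in Set.Ioi (0:ℝ), Fi k z v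

theorem Ff_deriv (k : ℕ) (z : ℂ) (hz : 0 < z.re) : HasDerivAt (Ff k) (-Ff (k+1) z) z := by
  have h := hasDerivAt_integral_of_dominated_loc_of_deriv_le
    (μ := MeasureTheory.volume.restrict (Set.Ioi (0:ℝ)))
    (F := Fi k) (F' := fun z v => - Fi (k+1) z v) (x₀ := z) (s := {w : ℂ | z.re / 2 < w.re})
    (bound := fun v : ℝ => 6 * (v ^ (k+1) * Real.exp (-(z.re/2) * v)))
    ?_ ?_ ?_ ?_ ?_ ?_ ?_
  · have h2 := h.2
    rw [MeasureTheory.integral_neg] at h2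
    exact h2
  · exact (isOpen_lt continuous_const Complex.continuous_re).mem_nhds (by simp; linarith)
  · exact Eventually.of_forall fun w => (Fi_meas k w).aestronglyMeasurable
  · exact Fi_int k z hz
  · exact (Fi_meas (k+1) z).neg.aestronglyMeasurable
  · filter_upwards [MeasureTheory.ae_restrict_mem measurableSet_Ioi] with v hv w hw
    rw [norm_neg]
    exact Fi_bound (k+1) w v _ hv (le_of_lt hw)
  · exact bd_int (k+1) _ (by linarith)
  · refine Eventually.of_forall fun v w hw => ?_
    unfold Fi
    have h1 : HasDerivAt (fun w : ℂ => -w * (v:ℂ)) (-1 * v) w :=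
      (hasDerivAt_id w).neg.mul_const _
    have h2 := h1.cexp.const_mul (((v ^ k * Ef v : ℝ) : ℂ))
    refine h2.congr_deriv ?_
    push_cast; ring

theorem Ff_iter (k : ℕ) : ∀ z : ℂ, 0 < z.re → iteratedDeriv k (Ff 0) z = (-1)^k * Ff k z := by
  induction k with
  | zero => intro z _; simp
  | succ k ih =>
    intro z hz
    rw [iteratedDeriv_succ]
    have : iteratedDeriv k (Ff 0) =ᶠ[nhds z] fun z => (-1)^k * Ff k z := by
      filter_upwards [(isOpen_lt continuous_const Complex.continuous_re).mem_nhds hz] with w hw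
      exact ih w hw
    rw [this.deriv_eq, ((Ff_deriv k z hz).const_mul _).deriv]
    ring

theorem psi_bigO : (fun n : ℕ ↦ ∑ k ∈ Finset.Icc 1 n, ArithmeticFunction.vonMangoldt k)
    =O[atTop] fun n ↦ (n : ℝ) ^ (1:ℝ) := by
  apply Asymptotics.IsBigO.of_bound (Real.log 4 + 4)
  refine Eventually.of_forall fun n => ?_
  have h := Chebyshev.psi_le_const_mul_self (x := n) (by positivity)
  have h0 := Chebyshev.psi_nonneg (n:ℝ)
  unfold Chebyshev.psi at h h0
  rw [Nat.floor_natCast] at h h0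
  have e : Finset.Icc 1 n = Finset.Ioc 0 n := by ext; simp [Nat.succ_le_iff]
  rw [e, Real.rpow_one, Real.norm_of_nonneg h0, Real.norm_of_nonneg (by positivity)]
  exact h

theorem Ff_zero_eq (z : ℂ) (hz : 0 < z.re) : Ff 0 z = Hf (1 + z) := by
  have hs1 : 1 < (1 + z).re := by simpa using hz
  have hz0 : z ≠ 0 := by rintro rfl; simp at hz
  have hs0 : (1 + z) ≠ 0 := by intro h; rw [h] at hs1; norm_num at hs1
  rw [Hf_eq (by simpa using hz0) hs0 (riemannZeta_ne_zero_of_one_le_re hs1.le)]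
  have h1 := LSeries_eq_mul_integral_of_nonneg (fun n => ArithmeticFunction.vonMangoldt n)
    zero_le_one hs1 psi_bigO (fun n => ArithmeticFunction.vonMangoldt_nonneg)
  have h2 := ArithmeticFunction.LSeries_vonMangoldt_eq_deriv_riemannZeta_div hs1
  have h3 : -(deriv riemannZeta (1+z) / riemannZeta (1+z)) / (1+z) =
      ∫ t in Set.Ioi (1 : ℝ), (∑ k ∈ Finset.Icc 1 ⌊t⌋₊, ((ArithmeticFunction.vonMangoldt k : ℝ) : ℂ)) * (t:ℂ) ^ (-((1+z) + 1)) := by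
    rw [← neg_div, ← h2, h1]
    field_simp
  have h4 : ∫ t in Set.Ioi (1 : ℝ), (∑ k ∈ Finset.Icc 1 ⌊t⌋₊, ((ArithmeticFunction.vonMangoldt k : ℝ) : ℂ)) * (t:ℂ) ^ (-((1+z) + 1))
     = ∫ v in Set.Ioi (0 : ℝ), (Fi 0 z v + Complex.exp (-z * v)) := by
    have := MeasureTheory.integral_comp_exp_Ioi (fun t : ℝ => (∑ k ∈ Finset.Icc 1 ⌊t⌋₊, ((ArithmeticFunction.vonMangoldt k : ℝ) : ℂ)) * (t:ℂ) ^ (-((1+z) + 1))) 0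
    rw [Real.exp_zero] at this
    rw [← this]
    congr 1
    ext v
    have e : Finset.Icc 1 ⌊Real.exp v⌋₊ = Finset.Ioc 0 ⌊Real.exp v⌋₊ := by ext; simp [Nat.succ_le_iff]
    rw [e, ← Complex.ofReal_sum]
    change _ • (((Chebyshev.psi (Real.exp v) : ℝ) : ℂ) * _) = _
    unfold Fi Ef
    have e2 : ((Real.exp v : ℝ) : ℂ) ^ (-((1+z) + 1)) = Complex.exp (-(v:ℂ)) * Complex.exp (-(v:ℂ)) * Complex.exp (-z * v) := by
      rw [Complex.cpow_def_of_ne_zero (by exact_mod_cast (Real.exp_pos v).ne'), ← Complex.ofReal_log (Real.exp_pos v).le,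
        Real.log_exp, ← Complex.exp_add, ← Complex.exp_add]
      congr 1; ring
    rw [e2, Complex.real_smul]
    have e3 : Complex.exp (v:ℂ) * Complex.exp (-(v:ℂ)) = 1 := by rw [← Complex.exp_add]; simp
    push_cast
    linear_combination (((Chebyshev.psi (Real.exp v) : ℝ) : ℂ) * Complex.exp (-(v:ℂ)) * Complex.exp (-z * v)) * e3
  have h5 : MeasureTheory.IntegrableOn (fun v : ℝ => Complex.exp (-z * v)) (Set.Ioi 0) :=
    integrableOn_exp_mul_complex_Ioi (by simpa using hz) 0
  have h6 : ∫ v in Set.Ioi (0 : ℝ), Complex.exp (-z * v) = z⁻¹ := by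
    rw [integral_exp_mul_complex_Ioi (by simpa using hz)]
    simp
  rw [h3, h4, MeasureTheory.integral_add (Fi_int 0 z hz) h5, h6]
  simp [Ff]

theorem Ff5_bound : ∃ C, 0 < C ∧ ∀ x y : ℝ, 0 < x → x ≤ 1 → ‖Ff 5 (x + Complex.I * y)‖ ≤ C := by
  obtain ⟨C, hC, h⟩ := Hf_bound
  refine ⟨C, hC, fun x y hx hx1 => ?_⟩
  have hz : 0 < ((x:ℂ) + Complex.I * y).re := by simpa using hx
  have h1 := Ff_iter 5 _ hz
  have h2 : Ff 0 =ᶠ[nhds ((x:ℂ) + Complex.I * y)] fun z => Hf (1 + z) := by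
    filter_upwards [(isOpen_lt continuous_const Complex.continuous_re).mem_nhds hz] with w hw
    exact Ff_zero_eq w hw
  rw [h2.iteratedDeriv_eq, iteratedDeriv_comp_const_add] at h1
  have h3 := h x y hx hx1
  rw [add_assoc] at h3
  have h4 := congrArg norm h1
  simp only [norm_mul, norm_pow, norm_neg, norm_one, one_pow, one_mul] at h4
  rw [← h4]; exact h3


open scoped FourierTransform in
theorem smoothing : ∃ (φ : ℝ → ℝ) (A : ℝ), Continuous φ ∧ (∀ x, 0 ≤ φ x) ∧ (∀ x, φ x ≤ 1) ∧
    (∀ x, |x| ≤ 1 → φ x = 1) ∧ (∀ x, 2 ≤ |x| → φ x = 0) ∧ 0 < A ∧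
    ∀ (f : ℝ → ℂ) (C : ℝ), 0 < C → MeasureTheory.Integrable f → (∀ ξ, ‖𝓕 f ξ‖ ≤ C) →
    ∀ u δ : ℝ, 0 < δ → ‖∫ v, f v * ((φ ((v - u) / δ) : ℝ) : ℂ)‖ ≤ C * A := by
  let b : ContDiffBump (0:ℝ) := ⟨1, 2, by norm_num, by norm_num⟩
  let ψ : ℝ → ℂ := fun x => ((b x : ℝ) : ℂ)
  have hψ1 : HasCompactSupport ψ := b.hasCompactSupport.comp_left (g := fun x : ℝ => (x:ℂ)) (by simp)
  have hψ2 : ContDiff ℝ (⊤ : ℕ∞) ψ := Complex.ofRealCLM.contDiff.comp b.contDiff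
  let Ψ := hψ1.toSchwartzMap hψ2
  let w := 𝓕⁻ Ψ
  have hw : ∀ x, 𝓕 (fun t => w t) x = ψ x := by
    intro x
    have : 𝓕 w = Ψ := FourierTransform.fourier_fourierInv_eq Ψ
    have h2 : (𝓕 w) x = Ψ x := by rw [this]
    exact h2
  have hwi : MeasureTheory.Integrable (fun t => w t) := w.integrable
  refine ⟨fun x => b x, (∫ t, ‖w t‖) + 1, b.continuous, fun x => b.nonneg, fun x => b.le_one, ?_, ?_,
    by have : 0 ≤ ∫ t, ‖w t‖ := MeasureTheory.integral_nonneg fun _ => norm_nonneg _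
       linarith, ?_⟩
  · intro x hx
    exact b.one_of_mem_closedBall (by simpa [b] using hx)
  · intro x hx
    exact b.zero_of_le_dist (by simpa [b] using hx)
  intro f C hC hf hFf u δ hδ
  let g : ℝ → ℂ := fun ξ => (δ:ℂ) * (Complex.exp (((2 * π * u * ξ : ℝ) : ℂ) * Complex.I) * w (δ * ξ))
  have hwδ : MeasureTheory.Integrable (fun ξ => w (δ * ξ)) := hwi.comp_mul_left' hδ.ne'
  have hgn : ∀ ξ, ‖g ξ‖ = δ * ‖w (δ * ξ)‖ := by
    intro ξ
    simp only [g, norm_mul, Complex.norm_exp_ofReal_mul_I, Complex.norm_real, one_mul,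
      Real.norm_of_nonneg hδ.le]
  have hg : MeasureTheory.Integrable g := by
    apply MeasureTheory.Integrable.const_mul
    refine hwδ.mono ?_ ?_
    · apply Continuous.aestronglyMeasurable
      have := w.continuous
      fun_prop
    · refine Eventually.of_forall fun ξ => ?_
      rw [norm_mul, Complex.norm_exp_ofReal_mul_I, one_mul]
  have hFg : ∀ v, 𝓕 g v = ((b ((v - u) / δ) : ℝ) : ℂ) := by
    intro v
    have h1 := hw ((v - u) / δ)
    rw [Real.fourier_real_eq_integral_exp_smul] at h1 ⊢
    change _ = ψ ((v - u) / δ)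
    rw [← h1]
    have h2 := MeasureTheory.Measure.integral_comp_mul_left (fun t : ℝ => Complex.exp (↑(-2 * π * t * ((v - u) / δ)) * Complex.I) • w t) δ
    rw [abs_of_pos (inv_pos.mpr hδ)] at h2
    have h3 : ∫ t : ℝ, Complex.exp (↑(-2 * π * t * ((v - u) / δ)) * Complex.I) • w t
        = (δ:ℂ) * ∫ x : ℝ, Complex.exp (↑(-2 * π * (δ * x) * ((v - u) / δ)) * Complex.I) • w (δ * x) := by
      rw [h2, Complex.real_smul, ← mul_assoc]
      push_cast
      rw [mul_inv_cancel₀ (by exact_mod_cast hδ.ne'), one_mul]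
    rw [h3, ← MeasureTheory.integral_const_mul]
    congr 1
    ext x
    simp only [g, smul_eq_mul]
    rw [show -2 * π * (δ * x) * ((v - u) / δ) = -2 * π * x * v + 2 * π * u * x by field_simp; ring]
    push_cast
    rw [add_mul, Complex.exp_add]
    ring
  have key : ∫ ξ, 𝓕 f ξ • g ξ = ∫ x, f x • 𝓕 g x := by
    simpa using! (VectorFourier.integral_fourierIntegral_smul_eq_flip (L := innerₗ ℝ)
      Real.continuous_fourierChar continuous_inner hf hg)
  have h5 : ∫ v, f v * ((b ((v - u) / δ) : ℝ) : ℂ) = ∫ ξ, 𝓕 f ξ • g ξ := by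
    rw [key]; congr 1; ext v; rw [hFg, smul_eq_mul]
  rw [h5]
  calc ‖∫ ξ, 𝓕 f ξ • g ξ‖ ≤ ∫ ξ, C * ‖g ξ‖ := by
        apply MeasureTheory.norm_integral_le_of_norm_le (hg.norm.const_mul C)
        refine Eventually.of_forall fun ξ => ?_
        rw [norm_smul]
        gcongr
        exact hFf ξ
    _ = C * ∫ t, ‖w t‖ := by
        rw [MeasureTheory.integral_const_mul]
        simp_rw [hgn]
        rw [MeasureTheory.integral_const_mul, MeasureTheory.Measure.integral_comp_mul_left (fun t => ‖w t‖) δ,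
          abs_of_pos (inv_pos.mpr hδ), smul_eq_mul, ← mul_assoc δ, mul_inv_cancel₀ hδ.ne', one_mul]
    _ ≤ _ := by gcongr; linarith

theorem psi_smooth : ∃ (φ : ℝ → ℝ) (A : ℝ), Continuous φ ∧ (∀ x, 0 ≤ φ x) ∧ (∀ x, φ x ≤ 1) ∧
    (∀ x, |x| ≤ 1 → φ x = 1) ∧ (∀ x, 2 ≤ |x| → φ x = 0) ∧ 0 < A ∧
    ∀ ε u δ : ℝ, 0 < ε → ε ≤ 1 → 0 < δ →
    |∫ v in Set.Ioi (0:ℝ), v ^ 5 * Ef v * Real.exp (-ε * v) * φ ((v - u) / δ)| ≤ A := by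
  obtain ⟨φ, A, h1, h2, h3, h4, h5, h6, H⟩ := smoothing
  obtain ⟨C, hC, hF⟩ := Ff5_bound
  refine ⟨φ, C * A, h1, h2, h3, h4, h5, by positivity, fun ε u δ hε hε1 hδ => ?_⟩
  have hm : MeasurableSet (Set.Ioi (0:ℝ)) := measurableSet_Ioi
  have := H ((Set.Ioi (0:ℝ)).indicator (Fi 5 ε)) C hC
    ((MeasureTheory.integrable_indicator_iff hm).mpr (Fi_int 5 ε (by simpa using hε))) ?_ u δ hδ
  · have e : ∫ v, (Set.Ioi (0:ℝ)).indicator (Fi 5 ε) v * ((φ ((v - u) / δ) : ℝ) : ℂ) =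
        ((∫ v in Set.Ioi (0:ℝ), v ^ 5 * Ef v * Real.exp (-ε * v) * φ ((v - u) / δ) : ℝ) : ℂ) := by
      rw [← integral_complex_ofReal, ← MeasureTheory.integral_indicator hm]
      congr 1
      ext v
      by_cases hv : v ∈ Set.Ioi (0:ℝ)
      · rw [Set.indicator_of_mem hv, Set.indicator_of_mem hv]
        unfold Fi; push_cast; ring
      · rw [Set.indicator_of_notMem hv, Set.indicator_of_notMem hv, zero_mul]
    rw [e, Complex.norm_real] at this
    exact this
  · intro ξ
    have := hF ε (2 * π * ξ) hε hε1
    convert this using 2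
    rw [Real.fourier_real_eq_integral_exp_smul]
    unfold Ff
    rw [← MeasureTheory.integral_indicator hm]
    congr 1
    ext v
    by_cases hv : v ∈ Set.Ioi (0:ℝ)
    · rw [Set.indicator_of_mem hv, Set.indicator_of_mem hv]
      unfold Fi
      rw [smul_eq_mul, mul_left_comm, ← Complex.exp_add]
      congr 2
      push_cast; ring
    · rw [Set.indicator_of_notMem hv, Set.indicator_of_notMem hv, smul_zero]

theorem psi_gap : ∃ K : ℝ, 0 < K ∧ ∀ u a : ℝ, 2 ≤ u → 0 < a → a ≤ 1 →
    Chebyshev.psi (Real.exp u) ≤ (1 - a) * Real.exp u → a ^ 2 * u ^ 5 ≤ K := by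
  obtain ⟨φ, A, h1, h2, h3, h4, h5, h6, H⟩ := psi_smooth
  refine ⟨1152 * A, by positivity, fun u a hu ha ha1 hψ => ?_⟩
  have hE : ∀ v, u - a / 3 ≤ v → v ≤ u → Ef v ≤ - a / 2 := by
    intro v hv1 hv2
    have e1 : Chebyshev.psi (Real.exp v) ≤ (1 - a) * Real.exp u :=
      (Chebyshev.psi_mono (Real.exp_le_exp.mpr hv2)).trans hψ
    have e2 : Real.exp u * Real.exp (-v) ≤ 1 + a / 3 + (a/3)^2 := by
      rw [← Real.exp_add]
      calc Real.exp (u + -v) ≤ Real.exp (a/3) := Real.exp_le_exp.mpr (by linarith)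
        _ ≤ _ := by
          have := Real.abs_exp_sub_one_sub_id_le (x := a/3) (by rw [abs_of_pos] <;> linarith)
          rw [abs_le] at this; linarith [this.2]
    have e3 : Chebyshev.psi (Real.exp v) * Real.exp (-v) ≤ (1 - a) * (1 + a / 3 + (a/3)^2) := by
      calc _ ≤ ((1 - a) * Real.exp u) * Real.exp (-v) := by gcongr
        _ = (1 - a) * (Real.exp u * Real.exp (-v)) := by ring
        _ ≤ _ := by
          have : 0 ≤ 1 - a := by linarith
          gcongr
    unfold Ef
    have : 0 < a ^ 3 := by positivity
    nlinarith
  set δ := a / 12 with hδ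
  set u₀ := u - a / 6 with hu₀
  have hδ0 : 0 < δ := by positivity
  have hup : 0 < u := by linarith
  have hb := H (1/u) u₀ δ (by positivity) (by rw [div_le_one hup]; linarith) hδ0
  set h := fun v : ℝ => v ^ 5 * Ef v * Real.exp (-(1/u) * v) * φ ((v - u₀) / δ) with hh
  set c := u ^ 5 / 32 * (a / 2) * (1 / 3) with hc
  have hsupp : ∀ v, φ ((v - u₀) / δ) ≠ 0 → u - a/3 ≤ v ∧ v ≤ u := by
    intro v hv
    have : |(v - u₀) / δ| < 2 := by
      by_contra hcon
      exact hv (h5 _ (not_lt.mp hcon))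
    rw [abs_div, abs_of_pos hδ0, div_lt_iff₀ hδ0, abs_lt] at this
    constructor <;> linarith [this.1, this.2]
  have hneg : ∀ v, 0 < v → 0 ≤ - h v := by
    intro v hv
    by_cases hz : φ ((v - u₀) / δ) = 0
    · simp [hh, hz]
    · obtain ⟨l1, l2⟩ := hsupp v hz
      have e := hE v l1 l2
      have : h v = -(v ^ 5 * (-Ef v) * Real.exp (-(1/u) * v) * φ ((v - u₀) / δ)) := by
        simp only [hh]; ring
      rw [this, neg_neg]
      have e2 : 0 ≤ - Ef v := by linarith
      have := h2 ((v - u₀) / δ)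
      positivity
  have hlow : ∀ v ∈ Set.Icc (u₀ - δ) (u₀ + δ), c ≤ - h v := by
    intro v hv
    have hv1 : u - a/3 ≤ v := by linarith [hv.1]
    have hv2 : v ≤ u := by linarith [hv.2]
    have hφ : φ ((v - u₀) / δ) = 1 := by
      apply h4
      rw [abs_div, abs_of_pos hδ0, div_le_one hδ0, abs_le]
      constructor <;> linarith [hv.1, hv.2]
    have e := hE v hv1 hv2
    have e1 : (u/2)^5 ≤ v^5 := by gcongr; linarith
    have e2 : 1/3 ≤ Real.exp (-(1/u) * v) := by
      calc (1/3:ℝ) ≤ Real.exp (-1) := by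
            rw [Real.exp_neg, one_div]
            apply inv_anti₀ (Real.exp_pos _)
            linarith [Real.exp_one_lt_d9]
        _ ≤ _ := by
            apply Real.exp_le_exp.mpr
            have : 1/u * v ≤ 1 := by rw [one_div, inv_mul_le_one₀ hup]; exact hv2
            linarith
    have e3 : - h v = v ^ 5 * (-Ef v) * Real.exp (-(1/u) * v) := by
      simp only [hh, hφ]; ring
    rw [e3, hc]
    have e4 : a / 2 ≤ - Ef v := by linarith
    have e5 : u ^ 5 / 32 ≤ v ^ 5 := by rw [div_pow] at e1; norm_num at e1 ⊢; exact e1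
    have e6 : 0 < v := by linarith
    have e7 : 0 ≤ - Ef v := by linarith
    have e8 : 0 ≤ v ^ 5 * - Ef v := by positivity
    gcongr
  have hIntg : MeasureTheory.IntegrableOn h (Set.Ioi 0) := by
    refine MeasureTheory.Integrable.mono' (bd_int 5 (1/u) (by positivity)) ?_ ?_
    · apply Measurable.aestronglyMeasurable
      have := Ef_meas
      have := h1.measurable
      simp only [hh]
      fun_prop
    · filter_upwards [MeasureTheory.ae_restrict_mem measurableSet_Ioi] with v hv
      have hv : 0 < v := hv
      simp only [hh, norm_mul, Real.norm_eq_abs, abs_of_pos (pow_pos hv 5), Real.abs_exp,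
        abs_of_nonneg (h2 _)]
      have := Ef_bound v
      have := h3 ((v - u₀) / δ)
      have := h2 ((v - u₀) / δ)
      calc _ ≤ v ^ 5 * 6 * Real.exp (-(1/u) * v) * 1 := by gcongr
        _ = _ := by ring
  have hsub : Set.Icc (u₀ - δ) (u₀ + δ) ⊆ Set.Ioi 0 := by
    intro v hv
    have : 0 < v := by linarith [hv.1]
    exact this
  have i1 : ∫ v in Set.Icc (u₀ - δ) (u₀ + δ), c ≤ ∫ v in Set.Icc (u₀ - δ) (u₀ + δ), - h v := by
    apply MeasureTheory.setIntegral_mono_on _ _ measurableSet_Icc hlow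
    · exact MeasureTheory.integrableOn_const (by simp) (by simp)
    · exact (hIntg.mono_set hsub).neg
  have i2 : ∫ v in Set.Icc (u₀ - δ) (u₀ + δ), - h v ≤ ∫ v in Set.Ioi 0, - h v := by
    apply MeasureTheory.setIntegral_mono_set hIntg.neg _ hsub.eventuallyLE
    filter_upwards [MeasureTheory.ae_restrict_mem measurableSet_Ioi] with v hv
    exact hneg v hv
  rw [MeasureTheory.integral_neg, MeasureTheory.integral_neg] at i2
  rw [MeasureTheory.integral_neg, MeasureTheory.setIntegral_const, smul_eq_mul, Real.volume_real_Icc_of_le (by linarith)] at i1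
  rw [abs_le] at hb
  have : (u₀ + δ - (u₀ - δ)) * c ≤ A := by linarith [hb.1]
  rw [hc, hδ] at this
  have e : (u₀ + a/12 - (u₀ - a/12)) * (u ^ 5 / 32 * (a / 2) * (1 / 3)) = a ^ 2 * u ^ 5 / 1152 := by ring
  rw [e] at this
  linarith

theorem psi_lower (η : ℝ) (hη : 0 < η) :
    ∀ᶠ x : ℝ in atTop, x - η * x / Real.log x ^ 2 ≤ Chebyshev.psi x := by
  obtain ⟨K, hK, H⟩ := psi_gap
  have hlog := Real.tendsto_log_atTop
  filter_upwards [eventually_gt_atTop 0, hlog.eventually_ge_atTop 2,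
    hlog.eventually_gt_atTop (K / η ^ 2), hlog.eventually_ge_atTop η] with x hx hl1 hl2 hl3
  by_contra hcon
  push Not at hcon
  have hl0 : 0 < Real.log x := by linarith
  have := H (Real.log x) (η / Real.log x ^ 2) hl1 (by positivity)
    (by rw [div_le_one (by positivity)]; nlinarith)
    (by rw [Real.exp_log hx]
        have : (1 - η / Real.log x ^ 2) * x = x - η * x / Real.log x ^ 2 := by ring
        linarith)
  have e : (η / Real.log x ^ 2) ^ 2 * Real.log x ^ 5 = η ^ 2 * Real.log x := by
    field_simp
  rw [e] at this
  rw [div_lt_iff₀ (by positivity)] at hl2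
  linarith


theorem log_pow_le (k : ℕ) (c : ℝ) (hc : 0 < c) : ∀ᶠ x : ℝ in atTop, Real.log x ^ k ≤ c * x := by
  have h := (Real.isLittleO_pow_log_id_atTop (n := k)).bound hc
  filter_upwards [h, eventually_gt_atTop 0] with x hx hx0
  simp only [id, Real.norm_eq_abs, abs_of_pos hx0] at hx
  exact (le_abs_self _).trans hx

theorem theta_lower : ∀ᶠ x : ℝ in atTop,
    x - 0.1 * x / Real.log x ^ 2 ≤ Chebyshev.theta x := by
  obtain ⟨C, hC⟩ := Chebyshev.psi_sub_theta_le_mul_sqrt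
  set D := |C| + 1 with hD
  have hD0 : 0 < D := by positivity
  have hCD : C ≤ D := by linarith [le_abs_self C]
  filter_upwards [psi_lower 0.05 (by norm_num), log_pow_le 4 ((0.05 / D)^2) (by positivity),
    eventually_gt_atTop 1] with x h1 h2 h3
  have h4 := hC x
  have hL : 0 < Real.log x := Real.log_pos h3
  have hs : 0 < √x := Real.sqrt_pos.mpr (by linarith)
  have hss : √x * √x = x := Real.mul_self_sqrt (by linarith)
  have h5 : Real.log x ^ 2 ≤ 0.05 / D * √x := by
    apply abs_le_of_sq_le_sq' _ (by positivity) |>.2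
    calc (Real.log x ^ 2)^2 = Real.log x ^ 4 := by ring
      _ ≤ (0.05 / D)^2 * x := h2
      _ = _ := by rw [mul_pow, sq √x, hss]
  have h6 : D * √x ≤ 0.05 * x / Real.log x ^ 2 := by
    rw [le_div_iff₀ (by positivity)]
    calc D * √x * Real.log x ^ 2 ≤ D * √x * (0.05 / D * √x) := by gcongr
      _ = 0.05 * (√x * √x) := by field_simp
      _ = _ := by rw [hss]
  have h7 : C * √x ≤ D * √x := by gcongr
  have h8 : 0.1 * x / Real.log x ^ 2 = 0.05 * x / Real.log x ^ 2 + 0.05 * x / Real.log x ^ 2 := by ring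
  linarith

noncomputable def Phi (t : ℝ) : ℝ := t / Real.log t ^ 2 + 1.5 * (t / Real.log t ^ 3)

theorem Phi_deriv (t : ℝ) (ht : 1 < t) :
    HasDerivAt Phi (1 / Real.log t ^ 2 - 0.5 / Real.log t ^ 3 - 4.5 / Real.log t ^ 4) t := by
  have hL : 0 < Real.log t := Real.log_pos ht
  have ht0 : t ≠ 0 := by linarith
  have h1 := Real.hasDerivAt_log ht0
  have h2 := (hasDerivAt_id t).div (h1.pow 2) (pow_pos hL _).ne.symm
  have h3 := (hasDerivAt_id t).div (h1.pow 3) (pow_pos hL _).ne.symm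
  have h4 := h2.add (h3.const_mul 1.5)
  refine h4.congr_deriv ?_
  simp only [Pi.pow_apply, id]
  field_simp
  norm_num
  ring

theorem pi_lower : ∀ᶠ x : ℝ in atTop,
    x / Real.log x + x / Real.log x ^ 2 + 1.25 * (x / Real.log x ^ 3) ≤ (Nat.primeCounting ⌊x⌋₊ : ℝ) := by
  obtain ⟨x₁, hx₁⟩ := eventually_atTop.mp theta_lower
  set x₀ := max x₁ 2 with hx₀
  have h02 : 2 ≤ x₀ := le_max_right _ _
  have hΦ0 : 0 < Phi x₀ := by
    have : 0 < Real.log x₀ := Real.log_pos (by linarith)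
    unfold Phi; positivity
  filter_upwards [eventually_ge_atTop x₀, log_pow_le 3 (0.15 / Phi x₀) (by positivity)] with x hx hl
  have hL : 0 < Real.log x := Real.log_pos (by linarith)
  rw [Chebyshev.primeCounting_eq_theta_div_log_add_integral (by linarith)]
  have hIntg : ∀ a b : ℝ, 2 ≤ a → a ≤ b → MeasureTheory.IntegrableOn
      (fun t ↦ Chebyshev.theta t / (t * Real.log t ^ 2)) (Set.Icc a b) MeasureTheory.volume :=
    fun a b ha hab => (Chebyshev.integrableOn_theta_div_id_mul_log_sq b).mono_set
      (Set.Icc_subset_Icc_left ha)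
  have hii : ∀ a b : ℝ, 2 ≤ a → a ≤ b → IntervalIntegrable
      (fun t ↦ Chebyshev.theta t / (t * Real.log t ^ 2)) MeasureTheory.volume a b :=
    fun a b ha hab => (intervalIntegrable_iff_integrableOn_Icc_of_le hab).mpr (hIntg a b ha hab)
  rw [← intervalIntegral.integral_add_adjacent_intervals (hii 2 x₀ le_rfl h02) (hii x₀ x h02 hx)]
  have i1 : 0 ≤ ∫ t in (2:ℝ)..x₀, Chebyshev.theta t / (t * Real.log t ^ 2) := by
    apply intervalIntegral.integral_nonneg h02
    intro t ht
    have := Chebyshev.theta_nonneg t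
    have : 0 < t := by linarith [ht.1]
    positivity
  have i2 : Phi x - Phi x₀ ≤ ∫ t in x₀..x, Chebyshev.theta t / (t * Real.log t ^ 2) := by
    apply intervalIntegral.sub_le_integral_of_hasDeriv_right_of_le hx
      (g' := fun t => 1 / Real.log t ^ 2 - 0.5 / Real.log t ^ 3 - 4.5 / Real.log t ^ 4)
    · intro t ht
      exact (Phi_deriv t (by linarith [ht.1])).continuousAt.continuousWithinAt
    · intro t ht
      exact (Phi_deriv t (by linarith [ht.1])).hasDerivWithinAt
    · exact hIntg _ _ h02 hx
    · intro t ht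
      have ht0 : 0 < t := by linarith [ht.1]
      have hl : 0 < Real.log t := Real.log_pos (by linarith [ht.1])
      have h1 := hx₁ t (le_trans (le_max_left _ _) ht.1.le)
      calc 1 / Real.log t ^ 2 - 0.5 / Real.log t ^ 3 - 4.5 / Real.log t ^ 4
          ≤ 1 / Real.log t ^ 2 - 0 - 0.1 / Real.log t ^ 4 := by
            gcongr
            · positivity
            · norm_num
        _ = (t - 0.1 * t / Real.log t ^ 2) / (t * Real.log t ^ 2) := by
            field_simp
            ring
        _ ≤ _ := by gcongr
  have h1 := hx₁ x (le_trans (le_max_left _ _) hx)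
  have h2 : x / Real.log x - 0.1 * (x / Real.log x ^ 3) ≤ Chebyshev.theta x / Real.log x := by
    rw [le_div_iff₀ hL]
    calc _ = x - 0.1 * x / Real.log x ^ 2 := by field_simp
      _ ≤ _ := h1
  have h3 : Phi x₀ ≤ 0.15 * (x / Real.log x ^ 3) := by
    rw [div_mul_eq_mul_div, le_div_iff₀ hΦ0] at hl
    rw [← mul_div_assoc, le_div_iff₀ (by positivity)]
    linarith
  have h4 : Phi x = x / Real.log x ^ 2 + 1.5 * (x / Real.log x ^ 3) := rfl
  linarith

theorem p_ge (n : ℕ) (hn : 1 ≤ n) : n + 1 ≤ p n := by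
  have := Nat.add_two_le_nth_prime (n - 1)
  unfold p; omega

theorem pi_p (n : ℕ) (hn : 1 ≤ n) : Nat.primeCounting (p n) = n := by
  unfold p Nat.primeCounting Nat.primeCounting'
  rw [Nat.count_succ, if_pos (Nat.prime_nth_prime _)]
  have := Nat.primeCounting'_nth_eq (n - 1)
  unfold Nat.primeCounting' at this
  rw [this]; omega

theorem p_tendsto : Tendsto (fun n : ℕ => (p n : ℝ)) atTop atTop := by
  refine tendsto_atTop_mono' atTop ?_ tendsto_natCast_atTop_atTop
  filter_upwards [eventually_ge_atTop 1] with n hn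
  have := p_ge n hn
  exact_mod_cast (by omega : n ≤ p n)

theorem p_upper : ∀ᶠ n : ℕ in atTop,
    (p n : ℝ) ≤ n * (Real.log (p n) - 1 - 0.2 / Real.log (p n)) := by
  filter_upwards [p_tendsto.eventually pi_lower, eventually_ge_atTop 1,
    (Real.tendsto_log_atTop.comp p_tendsto).eventually_ge_atTop 40] with n h1 hn h2
  simp only [Function.comp] at h2
  rw [Nat.floor_natCast, pi_p n hn] at h1
  set L := Real.log (p n)
  have hp : (0:ℝ) < p n := by
    have := p_ge n hn
    exact_mod_cast (by omega : 0 < p n)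
  set q : ℝ := (p n : ℝ)
  have hpos : 0 ≤ L - 1 - 0.2 / L := by
    have : 0.2 / L ≤ 1 := by rw [div_le_one] <;> linarith
    linarith
  have hL : 0 < L := by linarith
  have key : 1 ≤ (1 / L + 1 / L ^ 2 + 1.25 / L ^ 3) * (L - 1 - 0.2 / L) := by
    have : (1 / L + 1 / L ^ 2 + 1.25 / L ^ 3) * (L - 1 - 0.2 / L) - 1
        = (0.05 * L ^ 2 - 1.45 * L - 0.25) / L ^ 4 := by
      field_simp
      ring
    have h5 : 0 ≤ (0.05 * L ^ 2 - 1.45 * L - 0.25) / L ^ 4 := by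
      apply div_nonneg _ (by positivity)
      nlinarith
    linarith
  calc q = q * 1 := by ring
    _ ≤ q * ((1 / L + 1 / L ^ 2 + 1.25 / L ^ 3) * (L - 1 - 0.2 / L)) := by gcongr
    _ = (q / L + q / L ^ 2 + 1.25 * (q / L ^ 3)) * (L - 1 - 0.2 / L) := by ring
    _ ≤ _ := by gcongr

theorem stmt_14
    (h : ∀ᶠ n : ℕ in atTop,
      (1 + (n : ℝ) ^ (-2 : ℝ)) * (p (n + 1) : ℝ) ^ ((1 : ℝ) / (n + 1)) <
        (p n : ℝ) ^ ((1 : ℝ) / n)) :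
    ∀ᶠ n : ℕ in atTop,
      (p (n + 1) : ℝ) - p n < (Real.log (p n)) ^ 2 - 2 * Real.log (p n) + 1 := by
  filter_upwards [h, p_upper, eventually_ge_atTop 1,
    (Real.tendsto_log_atTop.comp p_tendsto).eventually_ge_atTop 40,
    p_tendsto.eventually (log_pow_le 4 0.05 (by norm_num))] with n h1 h2 hn h3 h4
  simp only [Function.comp] at h3
  have hp : (0:ℝ) < p n := by
    have := p_ge n hn
    exact_mod_cast (by omega : 0 < p n)
  have hp' : (0:ℝ) < p (n+1) := by
    have := p_ge (n+1) (by omega)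
    exact_mod_cast (by omega : 0 < p (n+1))
  have hn0 : (1:ℝ) ≤ n := by exact_mod_cast hn
  have hnp : (0:ℝ) < n := by linarith
  have hnr : (0:ℝ) < (n:ℝ) ^ (-2:ℝ) := Real.rpow_pos_of_pos hnp _
  have hlog := Real.log_lt_log (by positivity) h1
  rw [Real.log_mul (by positivity) (by positivity), Real.log_rpow hp', Real.log_rpow hp] at hlog
  have hl1 := Real.one_sub_inv_le_log_of_pos (show 0 < 1 + (n:ℝ) ^ (-2:ℝ) by positivity)
  have hr : (n:ℝ) ^ (-2:ℝ) = 1 / (n:ℝ) ^ 2 := by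
    rw [Real.rpow_neg hnp.le, one_div]; norm_cast
  rw [hr] at hl1 hlog
  have hl2 : 1 - (1 + 1 / (n:ℝ) ^ 2)⁻¹ = 1 / ((n:ℝ)^2 + 1) := by
    field_simp
    ring
  rw [hl2] at hl1
  set L := Real.log (p n) with hLdef
  set L' := Real.log (p (n+1)) with hL'def
  set q : ℝ := (p n : ℝ) with hq
  set q' : ℝ := (p (n+1) : ℝ) with hq'
  have hL' : L' < L + (L - 1) / n := by
    have e1 : L' / (n + 1) < L / n - 1 / ((n:ℝ)^2 + 1) := by
      have : 1 / ((n:ℝ) + 1) * L' = L' / (n + 1) := by ring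
      have : 1 / (n:ℝ) * L = L / n := by ring
      linarith
    rw [div_lt_iff₀ (by positivity)] at e1
    have e2 : 1 / (n:ℝ) ≤ 1 / ((n:ℝ)^2 + 1) * (n + 1) := by
      rw [div_mul_eq_mul_div, div_le_div_iff₀ (by positivity) (by positivity)]
      nlinarith
    have e3 : (L / n - 1 / ((n:ℝ)^2 + 1)) * (n + 1) = L + L / n - 1 / ((n:ℝ)^2 + 1) * (n + 1) := by
      field_simp
    have e4 : (L - 1) / n = L / n - 1 / n := by ring
    linarith
  set w := (L - 1) / n with hw
  have hw0 : 0 ≤ w := by apply div_nonneg <;> linarith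
  have hqn : q / n ≤ L - 1 - 0.2 / L := by
    rw [div_le_iff₀ hnp]; linarith
  have hL0 : 0 < L := by linarith
  have hd : 0 < 0.2 / L := by positivity
  have hqn0 : 0 < q / n := by positivity
  have hqw : q * w ≤ (L - 1)^2 - 0.1 := by
    have e1 : q * w = (q / n) * (L - 1) := by rw [hw]; ring
    have e2 : (q / n) * (L - 1) ≤ (L - 1 - 0.2 / L) * (L - 1) := by
      apply mul_le_mul_of_nonneg_right hqn; linarith
    have e3 : 0.2 / L * L = 0.2 := by field_simp
    have e4 : 0.2 / L ≤ 0.1 := by rw [div_le_iff₀ hL0]; linarith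
    nlinarith
  have hqw2 : q * w ^ 2 ≤ 0.05 := by
    have e1 : q * w ^ 2 = (q / n)^2 * (L - 1)^2 / q := by rw [hw]; field_simp
    rw [e1, div_le_iff₀ hp]
    calc (q / n)^2 * (L - 1)^2 ≤ L ^ 2 * L ^ 2 := by
          gcongr
          · linarith
          · linarith
          · linarith
      _ = L ^ 4 := by ring
      _ ≤ _ := h4
  have hq40 : 1 ≤ q := by
    have : (1:ℝ) ≤ p n := by
      have := p_ge n hn
      exact_mod_cast (by omega : 1 ≤ p n)
    exact this
  have hw1 : w ≤ 1 := by
    have : w ^ 2 ≤ 0.05 := by nlinarith [sq_nonneg w]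
    nlinarith
  have hexp : Real.exp w ≤ 1 + w + w ^ 2 := by
    have := Real.abs_exp_sub_one_sub_id_le (x := w) (by rw [abs_of_nonneg hw0]; exact hw1)
    rw [abs_le] at this; linarith [this.2]
  have hq'lt : q' < q * Real.exp w := by
    calc q' = Real.exp L' := (Real.exp_log hp').symm
      _ < Real.exp (L + w) := Real.exp_lt_exp.mpr hL'
      _ = _ := by rw [Real.exp_add, hLdef, Real.exp_log hp]
  have : q * Real.exp w ≤ q * (1 + w + w ^ 2) := by gcongr
  nlinarith
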